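/- (Resolvent equation: existence, uniqueness and bounds.) Let μ be a Lévy measure on ℝ^N \ {0} and ε > 0. (i) If g ∈ L¹(ℝ^N), then there exists a unique v ∈ L¹(ℝ^N) such that ∫_{ℝ^N} ( ε v ψ − v L^μ[ψ] ) dx = ∫_{ℝ^N} g ψ dx for all ψ ∈ C_c^∞(ℝ^N) (i.e. v is a distributional solution of εv − L^μ[v] = g), and this solution satisfies ε ‖v‖_{L¹(ℝ^N)} ≤ ‖g‖_{L¹(ℝ^N)}. (ii) If g ∈ L^∞(ℝ^N), then there exists a unique distributional solution v ∈ L^∞(ℝ^N) of εv − L^μ[v] = g, and it satisfies ε ‖v‖_{L^∞(ℝ^N)} ≤ ‖g‖_{L^∞(ℝ^N)}. -/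

import Mathlib

open MeasureTheory Set Filter

noncomputable section

/-- Euclidean space `ℝ^N`. -/
abbrev Euc (N : ℕ) := EuclideanSpace ℝ (Fin N)

variable {N : ℕ}

/-- `μ` is a (symmetric) Lévy measure on `ℝ^N ∖ {0}` : it is a nonnegative measure giving no
mass to `{0}`, symmetric (`μ(−B) = μ(B)`), and `∫ min(|z|²,1) dμ(z) < ∞`. -/
def IsLevyMeasure (μ : Measure (Euc N)) : Prop :=
  μ {0} = 0 ∧ μ.map (fun z => -z) = μ ∧
    ∫⁻ z, ENNReal.ofReal (min (‖z‖ ^ 2) 1) ∂μ ≠ ⊤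

/-- The nonlocal operator
`L^μ[ψ](x) = ∫ (ψ(x+z) − ψ(x) − z·Dψ(x) 1_{|z|≤1}) dμ(z)`. -/
def Lop (μ : Measure (Euc N)) (ψ : Euc N → ℝ) (x : Euc N) : ℝ :=
  ∫ z, (ψ (x + z) - ψ x - (if ‖z‖ ≤ 1 then fderiv ℝ ψ x z else 0)) ∂μ

/-- `ψ ∈ C_c^∞(ℝ^N)`. -/
def IsTestFn (ψ : Euc N → ℝ) : Prop :=
  ContDiff ℝ (⊤ : ℕ∞) ψ ∧ HasCompactSupport ψ

/-- `ψ ∈ C_c^∞(ℝ^N × [0,T))` : smooth, compactly supported, and the support stays away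
from `t = T` (but may touch `t = 0`). -/
def IsSTTestFn (T : ℝ) (ψ : Euc N → ℝ → ℝ) : Prop :=
  ContDiff ℝ (⊤ : ℕ∞) (Function.uncurry ψ) ∧ HasCompactSupport (Function.uncurry ψ) ∧
    tsupport (Function.uncurry ψ) ⊆ {p : Euc N × ℝ | p.2 < T}

/-- `ψ ∈ C_c^∞(Q_T)` : smooth, compactly supported inside the open cylinder
`ℝ^N × (0,T)`. -/
def IsIntTestFn (T : ℝ) (ψ : Euc N → ℝ → ℝ) : Prop :=
  ContDiff ℝ (⊤ : ℕ∞) (Function.uncurry ψ) ∧ HasCompactSupport (Function.uncurry ψ) ∧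
    tsupport (Function.uncurry ψ) ⊆ {p : Euc N × ℝ | 0 < p.2 ∧ p.2 < T}

/-- The natural measure on the cylinder `Q_T = ℝ^N × (0,T)`. -/
def QTvol (N : ℕ) (T : ℝ) : Measure (Euc N × ℝ) :=
  (volume : Measure (Euc N)).prod ((volume : Measure ℝ).restrict (Ioo 0 T))

/-- `u ∈ L^∞(Q_T)`. -/
def MemLinfQT (T : ℝ) (u : Euc N → ℝ → ℝ) : Prop :=
  AEStronglyMeasurable (fun p : Euc N × ℝ => u p.1 p.2) (QTvol N T) ∧
    ∃ C : ℝ, ∀ᵐ p ∂(QTvol N T), |u p.1 p.2| ≤ C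

/-- `u ∈ L¹(Q_T)`. -/
def MemL1QT (T : ℝ) (u : Euc N → ℝ → ℝ) : Prop :=
  Integrable (fun p : Euc N × ℝ => u p.1 p.2) (QTvol N T)

/-- `u ∈ C([0,T]; L¹_loc(ℝ^N))` : for every compact `K`, `t ↦ u(·,t)` is continuous
from `[0,T]` into `L¹(K)`. -/
def MemCL1loc (T : ℝ) (u : Euc N → ℝ → ℝ) : Prop :=
  ∀ K : Set (Euc N), IsCompact K →
    (∀ t ∈ Icc (0 : ℝ) T, IntegrableOn (fun x => u x t) K) ∧
    ∀ t ∈ Icc (0 : ℝ) T,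
      Tendsto (fun s => ∫ x in K, |u x s - u x t|) (nhdsWithin t (Icc 0 T)) (nhds 0)

/-- `u` is a distributional solution of `∂_t u − A[φ(u)] = 0` in `Q_T` with initial
datum `u0` : for all `ψ ∈ C_c^∞(ℝ^N × [0,T))`,
`∫₀^T ∫ (u ∂_t ψ + φ(u) A[ψ(·,t)]) dx dt + ∫ u0(x) ψ(x,0) dx = 0`. -/
def IsDistSolOp (T : ℝ) (A : (Euc N → ℝ) → Euc N → ℝ) (φ : ℝ → ℝ)
    (u0 : Euc N → ℝ) (u : Euc N → ℝ → ℝ) : Prop :=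
  ∀ ψ : Euc N → ℝ → ℝ, IsSTTestFn T ψ →
    (∫ t in Ioo (0 : ℝ) T, ∫ x,
        (u x t * deriv (ψ x) t + φ (u x t) * A (fun y => ψ y t) x))
      + ∫ x, u0 x * ψ x 0 = 0

/-- `u0 ∈ L^∞(ℝ^N)`. -/
def MemLinfRn (u0 : Euc N → ℝ) : Prop :=
  AEStronglyMeasurable u0 (volume : Measure (Euc N)) ∧
    ∃ C : ℝ, ∀ᵐ x : Euc N ∂volume, |u0 x| ≤ C

end

section Resolvent

variable {N : ℕ}

/-! ### Lévy measures -/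

/-- The weight `min (|z|²) 1` is integrable against a Lévy measure. -/
lemma IsLevyMeasure.integrable_min {μ : Measure (Euc N)} (hμ : IsLevyMeasure μ) :
    Integrable (fun z : Euc N => min (‖z‖ ^ 2) 1) μ := by
  refine ⟨by fun_prop, ?_⟩
  rw [hasFiniteIntegral_iff_ofReal (Eventually.of_forall fun z => by positivity)]
  exact hμ.2.2.lt_top

/-- A Lévy measure gives finite mass to the complement of a ball around the origin. -/
lemma IsLevyMeasure.measure_norm_gt_lt_top {μ : Measure (Euc N)} (hμ : IsLevyMeasure μ)
    {r : ℝ} (hr : 0 < r) : μ {z | r < ‖z‖} < ⊤ := by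
  refine (measure_mono ?_).trans_lt
    (hμ.integrable_min.measure_ge_lt_top (ε := min (r ^ 2) 1) (by positivity))
  intro z (hz : r < ‖z‖)
  exact min_le_min_right _ (pow_le_pow_left₀ hr.le hz.le 2)

/-- Restricting a Lévy measure to the complement of a ball gives a Lévy measure. -/
lemma IsLevyMeasure.restrict_norm_gt {μ : Measure (Euc N)} (hμ : IsLevyMeasure μ) (r : ℝ) :
    IsLevyMeasure (μ.restrict {z | r < ‖z‖}) := by
  have hs : MeasurableSet {z : Euc N | r < ‖z‖} := measurableSet_lt (by fun_prop) (by fun_prop)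
  refine ⟨?_, ?_, ?_⟩
  · exact le_antisymm ((Measure.restrict_apply_le _ _).trans_eq hμ.1) (zero_le)
  · conv_rhs => rw [← hμ.2.1]
    rw [Measure.restrict_map measurable_neg hs]
    simp
  · exact ((lintegral_mono' Measure.restrict_le_self le_rfl).trans_lt hμ.2.2.lt_top).ne

/-- The integral of an odd function against a symmetric measure vanishes. -/
lemma IsLevyMeasure.integral_odd {μ : Measure (Euc N)} (hμ : IsLevyMeasure μ)
    {f : Euc N → ℝ} (hf : ∀ z, f (-z) = -f z) : ∫ z, f z ∂μ = 0 := by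
  have h : ∫ z, f z ∂μ = ∫ z, f (-z) ∂μ := by
    conv_lhs => rw [← hμ.2.1]
    exact integral_map_equiv (MeasurableEquiv.neg (Euc N)) f
  simp only [hf, integral_neg] at h
  linarith

/-! ### The nonlocal operator on test functions -/

/-- The integrand of the nonlocal operator `Lop`. -/
noncomputable def levyIncrement (ψ : Euc N → ℝ) (x z : Euc N) : ℝ :=
  ψ (x + z) - ψ x - (if ‖z‖ ≤ 1 then fderiv ℝ ψ x z else 0)

lemma IsTestFn.continuous {ψ : Euc N → ℝ} (hψ : IsTestFn ψ) : Continuous ψ := hψ.1.continuous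

lemma IsTestFn.differentiable {ψ : Euc N → ℝ} (hψ : IsTestFn ψ) : Differentiable ℝ ψ :=
  hψ.1.differentiable (by simp)

lemma IsTestFn.continuous_fderiv {ψ : Euc N → ℝ} (hψ : IsTestFn ψ) :
    Continuous (fderiv ℝ ψ) := hψ.1.continuous_fderiv (by simp)

lemma IsTestFn.exists_bound {ψ : Euc N → ℝ} (hψ : IsTestFn ψ) : ∃ C, ∀ x, |ψ x| ≤ C :=
  hψ.2.exists_bound_of_continuous hψ.continuous

lemma IsTestFn.integrable {ψ : Euc N → ℝ} (hψ : IsTestFn ψ) :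
    Integrable ψ (volume : Measure (Euc N)) :=
  hψ.continuous.integrable_of_hasCompactSupport hψ.2

/-- Test functions are Lipschitz and satisfy a uniform second order Taylor estimate. -/
lemma IsTestFn.exists_taylor_bound {ψ : Euc N → ℝ} (hψ : IsTestFn ψ) :
    ∃ K : ℝ, 0 ≤ K ∧ (∀ x z, |ψ (x + z) - ψ x| ≤ K * ‖z‖) ∧ (∀ x z, |ψ (x + z) - ψ x| ≤ K) ∧
      ∀ x z, |ψ (x + z) - ψ x - fderiv ℝ ψ x z| ≤ K * ‖z‖ ^ 2 := by
  obtain ⟨A, hA⟩ := hψ.exists_bound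
  obtain ⟨B, hB⟩ := hψ.1.lipschitzWith_of_hasCompactSupport hψ.2 (by simp)
  obtain ⟨C, hC⟩ := ContDiff.lipschitzWith_of_hasCompactSupport (n := 1) (𝕂 := ℝ)
    (hψ.2.fderiv ℝ) (hψ.1.fderiv_right (WithTop.coe_le_coe.2 (le_top (a := (1 + 1 : ℕ∞))))) (by simp)
  have hA0 : 0 ≤ A := (abs_nonneg _).trans (hA 0)
  refine ⟨2 * A + B + C, by positivity, fun x z => ?_, fun x z => ?_, fun x z => ?_⟩
  · have := hB.dist_le_mul (x + z) x
    simp only [Real.dist_eq, dist_self_add_left] at this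
    refine this.trans ?_
    gcongr
    linarith [C.2]
  · have h1 := abs_sub (ψ (x + z)) (ψ x)
    linarith [hA (x + z), hA x, B.2, C.2]
  · have h := (convex_closedBall x ‖z‖).norm_image_sub_le_of_norm_fderiv_le' (𝕜 := ℝ)
      (f := ψ) (φ := fderiv ℝ ψ x) (C := C * ‖z‖) (x := x) (y := x + z)
      (fun y _ => hψ.differentiable y) (fun y hy => ?_) (by simp) (by simp)
    · simp only [add_sub_cancel_left, Real.norm_eq_abs] at h
      refine h.trans ?_
      rw [mul_assoc, ← sq]
      gcongr
      linarith [B.2]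
    · have := hC.dist_le_mul y x
      rw [dist_eq_norm] at this
      refine this.trans ?_
      gcongr
      exact hy

lemma abs_levyIncrement_le {ψ : Euc N → ℝ} {x z : Euc N} {K : ℝ}
    (h1 : |ψ (x + z) - ψ x| ≤ K) (h2 : |ψ (x + z) - ψ x - fderiv ℝ ψ x z| ≤ K * ‖z‖ ^ 2) :
    |levyIncrement ψ x z| ≤ K * min (‖z‖ ^ 2) 1 := by
  unfold levyIncrement
  split_ifs with hz
  · rwa [min_eq_left (by nlinarith [norm_nonneg z])]
  · rwa [min_eq_right (by nlinarith [norm_nonneg z]), mul_one, sub_zero]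

lemma IsTestFn.exists_levyIncrement_bound {ψ : Euc N → ℝ} (hψ : IsTestFn ψ) :
    ∃ K : ℝ, 0 ≤ K ∧ ∀ x z, |levyIncrement ψ x z| ≤ K * min (‖z‖ ^ 2) 1 := by
  obtain ⟨K, hK0, -, hK1, hK2⟩ := hψ.exists_taylor_bound
  exact ⟨K, hK0, fun x z => abs_levyIncrement_le (hK1 x z) (hK2 x z)⟩

lemma IsTestFn.measurable_levyIncrement {ψ : Euc N → ℝ} (hψ : IsTestFn ψ) (x : Euc N) :
    Measurable (levyIncrement ψ x) := by
  have := hψ.continuous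
  unfold levyIncrement
  refine Measurable.sub (by fun_prop) (Measurable.ite ?_ (by fun_prop) measurable_const)
  exact measurableSet_le (by fun_prop) (by fun_prop)

lemma IsTestFn.integrable_levyIncrement {μ : Measure (Euc N)} (hμ : IsLevyMeasure μ)
    {ψ : Euc N → ℝ} (hψ : IsTestFn ψ) (x : Euc N) : Integrable (levyIncrement ψ x) μ := by
  obtain ⟨K, -, hK⟩ := hψ.exists_levyIncrement_bound
  exact (hμ.integrable_min.const_mul K).mono' (hψ.measurable_levyIncrement x).aestronglyMeasurable
    (Eventually.of_forall (hK x))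

lemma Lop_eq_integral_levyIncrement (μ : Measure (Euc N)) (ψ : Euc N → ℝ) (x : Euc N) :
    Lop μ ψ x = ∫ z, levyIncrement ψ x z ∂μ := rfl

lemma IsTestFn.continuous_Lop {μ : Measure (Euc N)} (hμ : IsLevyMeasure μ)
    {ψ : Euc N → ℝ} (hψ : IsTestFn ψ) : Continuous (Lop μ ψ) := by
  obtain ⟨K, -, hK⟩ := hψ.exists_levyIncrement_bound
  refine continuous_of_dominated (F := levyIncrement ψ)
    (fun x => (hψ.measurable_levyIncrement x).aestronglyMeasurable)
    (fun x => Eventually.of_forall (hK x)) (hμ.integrable_min.const_mul K)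
    (Eventually.of_forall fun z => ?_)
  have h1 := hψ.continuous
  have h2 := hψ.continuous_fderiv
  unfold levyIncrement
  split_ifs <;> fun_prop

lemma abs_Lop_le {μ : Measure (Euc N)} {ψ : Euc N → ℝ} {x : Euc N} {b : Euc N → ℝ}
    (hb : Integrable b μ) (h : ∀ z, |levyIncrement ψ x z| ≤ b z) :
    |Lop μ ψ x| ≤ ∫ z, b z ∂μ :=
  norm_integral_le_of_norm_le (f := levyIncrement ψ x) hb (Eventually.of_forall h)

lemma IsTestFn.exists_Lop_bound {μ : Measure (Euc N)} (hμ : IsLevyMeasure μ)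
    {ψ : Euc N → ℝ} (hψ : IsTestFn ψ) : ∃ C, ∀ x, |Lop μ ψ x| ≤ C := by
  obtain ⟨K, -, hK⟩ := hψ.exists_levyIncrement_bound
  exact ⟨_, fun x => abs_Lop_le (hμ.integrable_min.const_mul K) (hK x)⟩

lemma IsTestFn.comp_add_right {ψ : Euc N → ℝ} (hψ : IsTestFn ψ) (a : Euc N) :
    IsTestFn (fun x => ψ (x + a)) :=
  ⟨hψ.1.comp (by fun_prop), hψ.2.comp_homeomorph (Homeomorph.addRight a)⟩

lemma Lop_comp_add_right (μ : Measure (Euc N)) (ψ : Euc N → ℝ) (a x : Euc N) :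
    Lop μ (fun y => ψ (y + a)) x = Lop μ ψ (x + a) := by
  unfold Lop
  simp only [fderiv_comp_add_right, add_right_comm x _ a]

/-- Translates of an integrable function, averaged over a finite measure, are jointly
integrable. -/
lemma integrable_prod_comp_add {f : Euc N → ℝ} (hf : Integrable f (volume : Measure (Euc N)))
    (ν : Measure (Euc N)) [IsFiniteMeasure ν] :
    Integrable (fun p : Euc N × Euc N => f (p.2 + p.1)) (ν.prod volume) :=
  (measurePreserving_prod_add_right ν (volume : Measure (Euc N))).integrable_comp_of_integrable
    (hf.comp_snd ν)

lemma IsTestFn.integrable_Lop {μ : Measure (Euc N)} (hμ : IsLevyMeasure μ)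
    {ψ : Euc N → ℝ} (hψ : IsTestFn ψ) : Integrable (Lop μ ψ) (volume : Measure (Euc N)) := by
  obtain ⟨C, hC⟩ := hψ.exists_Lop_bound hμ
  obtain ⟨R, hR⟩ := hψ.2.isCompact.isBounded.subset_closedBall 0
  have hzero : ∀ y : Euc N, R < ‖y‖ → ψ y = 0 := fun y hy =>
    image_eq_zero_of_notMem_tsupport fun h => by
      have := hR h
      simp only [mem_closedBall_zero_iff] at this
      linarith
  have hs : MeasurableSet {z : Euc N | 1 < ‖z‖} := measurableSet_lt (by fun_prop) (by fun_prop)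
  set ν := μ.restrict {z : Euc N | 1 < ‖z‖} with hν
  have : IsFiniteMeasure ν :=
    isFiniteMeasure_restrict.2 (hμ.measure_norm_gt_lt_top one_pos).ne
  have hintg := (integrable_prod_comp_add hψ.integrable ν).abs.integral_prod_right
  have hball : Integrable ((Metric.closedBall (0 : Euc N) (R + 1)).indicator fun _ => C) volume :=
    (integrable_indicator_iff Metric.isClosed_closedBall.measurableSet).2
      (integrableOn_const (isCompact_closedBall _ _).measure_lt_top.ne)
  refine (hball.add hintg).mono' (hψ.continuous_Lop hμ).aestronglyMeasurable
    (Eventually.of_forall fun x => ?_)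
  have hnn : 0 ≤ ∫ z, |ψ (x + z)| ∂ν := integral_nonneg fun z => abs_nonneg _
  simp only [Pi.add_apply, Real.norm_eq_abs]
  by_cases hx : x ∈ Metric.closedBall (0 : Euc N) (R + 1)
  · rw [indicator_of_mem hx]
    linarith [hC x]
  · rw [indicator_of_notMem hx, zero_add]
    simp only [mem_closedBall_zero_iff, not_le] at hx
    have hLx : Lop μ ψ x = ∫ z, ψ (x + z) ∂ν := by
      rw [hν, ← integral_indicator hs]
      refine integral_congr_ae (Eventually.of_forall fun z => ?_)
      have hψx : ψ =ᶠ[nhds x] 0 := by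
        filter_upwards [(isOpen_lt continuous_const continuous_norm).mem_nhds
          (show R < ‖x‖ by linarith)] with y hy using hzero y hy
      have hfd : fderiv ℝ ψ x = 0 := by rw [hψx.fderiv_eq]; simp
      simp only [hψx.self_of_nhds, hfd, indicator, mem_ofPred_eq]
      by_cases hz : ‖z‖ ≤ 1
      · have : R < ‖x + z‖ := by
          have := norm_sub_le (x + z) z
          simp only [add_sub_cancel_right] at this
          linarith
        simp [hz, not_lt.2 hz, hzero _ this]
      · simp [hz, not_le.1 hz]
    rw [hLx]
    exact abs_integral_le_integral_abs

/-- For a finite Lévy measure, the symmetry removes the gradient term. -/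
lemma IsTestFn.Lop_of_isFiniteMeasure {ν : Measure (Euc N)} [IsFiniteMeasure ν]
    (hν : IsLevyMeasure ν) {ψ : Euc N → ℝ} (hψ : IsTestFn ψ) (x : Euc N) :
    Lop ν ψ x = ∫ z, ψ (z + x) ∂ν - ν.real univ * ψ x := by
  obtain ⟨C, hC⟩ := hψ.exists_bound
  have hcont := hψ.continuous
  have h1 : Integrable (fun z => ψ (x + z)) ν :=
    Integrable.of_bound (by fun_prop) C (Eventually.of_forall fun z => hC _)
  have h12 : Integrable (fun z => ψ (x + z) - ψ x) ν := h1.sub (integrable_const _)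
  have h3 : Integrable (fun z : Euc N => if ‖z‖ ≤ 1 then fderiv ℝ ψ x z else 0) ν := by
    refine (h12.sub (hψ.integrable_levyIncrement hν x)).congr (Eventually.of_forall fun z => ?_)
    simp [levyIncrement]
  have h0 : ∫ z : Euc N, (if ‖z‖ ≤ 1 then fderiv ℝ ψ x z else 0) ∂ν = 0 :=
    hν.integral_odd fun z => by
      simp only [norm_neg, map_neg]
      split_ifs <;> simp
  rw [Lop, integral_sub h12 h3, h0, integral_sub h1 (integrable_const _)]
  simp [add_comm x]

/-! ### The resolvent kernel of a finite measure -/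

/-- The Neumann series: if `b + a ν(ℝ^N) = 1` and `0 < b`, there is a probability measure `P` with
`P = b δ₀ + a ν ∗ P`. -/
lemma exists_isProbabilityMeasure_eq_add_conv (ν : Measure (Euc N)) [IsFiniteMeasure ν]
    (a b : ENNReal) (hb : b ≠ 0) (hab : b + a * ν univ = 1) :
    ∃ P : Measure (Euc N), IsProbabilityMeasure P ∧
      P = b • Measure.dirac 0 + a • (ν ∗ P) := by
  obtain ⟨m, hm0, hms⟩ : ∃ m : ℕ → Measure (Euc N),
      m 0 = b • Measure.dirac 0 ∧ ∀ k, m (k + 1) = a • (ν ∗ m k) :=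
    ⟨fun k => Nat.rec (b • Measure.dirac 0) (fun _ ρ => a • (ν ∗ ρ)) k, rfl, fun _ => rfl⟩
  have hb1 : b ≤ 1 := by rw [← hab]; exact le_self_add
  have hbt : b ≠ ⊤ := ne_top_of_le_ne_top ENNReal.one_ne_top hb1
  have hsf : ∀ k, SFinite (m k) := by
    intro k
    induction k with
    | zero => rw [hm0]; infer_instance
    | succ k ih => rw [hms]; infer_instance
  have hmass : ∀ k, m k univ = b * (a * ν univ) ^ k := by
    intro k
    induction k with
    | zero => simp [hm0]
    | succ k ih =>
      rw [hms, Measure.smul_apply, Measure.conv, Measure.map_apply (by fun_prop) .univ,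
        preimage_univ, ← univ_prod_univ, Measure.prod_prod, ih, smul_eq_mul]
      ring
  have hsub : 1 - a * ν univ = b := by
    rw [← hab]
    exact ENNReal.add_sub_cancel_right
      (ne_top_of_le_ne_top ENNReal.one_ne_top (by rw [← hab]; exact le_add_self))
  refine ⟨Measure.sum m, ⟨?_⟩, ?_⟩
  · rw [Measure.sum_apply _ .univ]
    simp only [hmass]
    rw [ENNReal.tsum_mul_left, ENNReal.tsum_geometric, hsub, ENNReal.mul_inv_cancel hb hbt]
  · have hconv : ν ∗ Measure.sum m = Measure.sum fun k => ν ∗ m k := by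
      simp only [Measure.conv]
      rw [Measure.prod_sum_right, Measure.map_sum (by fun_prop)]
    ext s hs
    rw [hconv, Measure.sum_apply _ hs, Measure.add_apply, Measure.smul_apply _ (Measure.sum _),
      Measure.sum_apply _ hs, tsum_eq_zero_add' ENNReal.summable, hm0, smul_eq_mul,
      ← ENNReal.tsum_mul_left]
    simp [hms]

/-- The resolvent kernel of a finite Lévy measure. -/
lemma IsLevyMeasure.exists_resolvent_of_isFiniteMeasure {ν : Measure (Euc N)} [IsFiniteMeasure ν]
    (hν : IsLevyMeasure ν) {ε : ℝ} (hε : 0 < ε) :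
    ∃ P : ProbabilityMeasure (Euc N), ∀ ψ : Euc N → ℝ, IsTestFn ψ →
      ε * ∫ z, ψ z ∂(P : Measure (Euc N)) = ε * ψ 0 + ∫ z, Lop ν ψ z ∂(P : Measure (Euc N)) := by
  set l := ν.real univ with hl
  have hl0 : 0 ≤ l := measureReal_nonneg
  have hεl : 0 < ε + l := by positivity
  obtain ⟨P, hP, hPeq⟩ := exists_isProbabilityMeasure_eq_add_conv ν (ENNReal.ofReal (1 / (ε + l)))
    (ENNReal.ofReal (ε / (ε + l))) (by simp; positivity) (by
      rw [← ofReal_measureReal (μ := ν) (s := univ), ← ENNReal.ofReal_mul (by positivity),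
        ← ENNReal.ofReal_add (by positivity) (by positivity), ← hl, ← ENNReal.ofReal_one]
      congr 1
      field_simp)
  refine ⟨⟨P, hP⟩, fun ψ hψ => ?_⟩
  obtain ⟨C, hC⟩ := hψ.exists_bound
  have hcont := hψ.continuous
  have hintg : ∀ (ρ : Measure (Euc N)) [IsFiniteMeasure ρ], Integrable ψ ρ := fun ρ _ =>
    Integrable.of_bound (by fun_prop) C (Eventually.of_forall fun z => hC _)
  have hprod : Integrable (fun p : Euc N × Euc N => ψ (p.1 + p.2)) (ν.prod P) :=
    Integrable.of_bound (by fun_prop) C (Eventually.of_forall fun z => hC _)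
  have hconv : ∫ z, ψ z ∂(ν ∗ P) = ∫ x, ∫ z, ψ (z + x) ∂ν ∂P := by
    rw [integral_conv (hintg _)]
    exact integral_integral_swap hprod
  have hL : ∫ z, Lop ν ψ z ∂P = ∫ z, ψ z ∂(ν ∗ P) - l * ∫ z, ψ z ∂P := by
    simp only [hψ.Lop_of_isFiniteMeasure hν]
    rw [integral_sub hprod.integral_prod_right ((hintg P).const_mul _), integral_const_mul, hconv]
  have hkey : ∫ z, ψ z ∂P = ε / (ε + l) * ψ 0 + 1 / (ε + l) * ∫ z, ψ z ∂(ν ∗ P) := by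
    conv_lhs => rw [hPeq]
    rw [integral_add_measure ((hintg _).smul_measure ENNReal.ofReal_ne_top)
      ((hintg _).smul_measure ENNReal.ofReal_ne_top), integral_smul_measure, integral_smul_measure,
      integral_dirac, ENNReal.toReal_ofReal (by positivity), ENNReal.toReal_ofReal (by positivity)]
    rfl
  change ε * ∫ z, ψ z ∂P = ε * ψ 0 + ∫ z, Lop ν ψ z ∂P
  rw [hL]
  field_simp at hkey
  linarith

/-! ### Tightness of the approximating kernels -/

/-- A majorant of the increments of a test function dilated by the factor `r`. -/
noncomputable def dilationBound (r : ℝ) (z : Euc N) : ℝ :=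
  if ‖z‖ ≤ 1 then ‖z‖ ^ 2 / r ^ 2 else min (‖z‖ / r) 1

lemma measurable_dilationBound (r : ℝ) : Measurable (dilationBound (N := N) r) :=
  Measurable.ite (measurableSet_le (by fun_prop) (by fun_prop)) (by fun_prop) (by fun_prop)

lemma dilationBound_nonneg {r : ℝ} (hr : 0 < r) (z : Euc N) : 0 ≤ dilationBound r z := by
  unfold dilationBound
  split_ifs <;> positivity

lemma dilationBound_le {r : ℝ} (hr : 1 ≤ r) (z : Euc N) :
    dilationBound r z ≤ min (‖z‖ ^ 2) 1 := by
  unfold dilationBound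
  split_ifs with hz
  · rw [min_eq_left (by nlinarith [norm_nonneg z])]
    exact div_le_self (by positivity) (one_le_pow₀ hr)
  · rw [min_eq_right (a := ‖z‖ ^ 2) (by nlinarith [norm_nonneg z])]
    exact min_le_right _ _

lemma IsLevyMeasure.integrable_dilationBound {μ : Measure (Euc N)} (hμ : IsLevyMeasure μ)
    {r : ℝ} (hr : 1 ≤ r) : Integrable (dilationBound r) μ :=
  hμ.integrable_min.mono' (measurable_dilationBound r).aestronglyMeasurable
    (Eventually.of_forall fun z => by
      rw [Real.norm_of_nonneg (dilationBound_nonneg (by linarith) z)]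
      exact dilationBound_le hr z)

lemma IsLevyMeasure.tendsto_integral_dilationBound {μ : Measure (Euc N)} (hμ : IsLevyMeasure μ) :
    Tendsto (fun r : ℝ => ∫ z, dilationBound r z ∂μ) atTop (nhds 0) := by
  rw [← integral_zero (Euc N) ℝ (μ := μ)]
  refine tendsto_integral_filter_of_dominated_convergence (fun z => min (‖z‖ ^ 2) 1)
    (Eventually.of_forall fun r => (measurable_dilationBound r).aestronglyMeasurable) ?_
    hμ.integrable_min (Eventually.of_forall fun z => ?_)
  · filter_upwards [eventually_ge_atTop 1] with r hr
    refine Eventually.of_forall fun z => ?_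
    rw [Real.norm_of_nonneg (dilationBound_nonneg (by linarith) z)]
    exact dilationBound_le hr z
  · unfold dilationBound
    split_ifs
    · exact (tendsto_pow_atTop two_ne_zero).const_div_atTop _
    · have h := (tendsto_id.const_div_atTop ‖z‖ : Tendsto (fun r : ℝ => ‖z‖ / r) _ _).min
        (tendsto_const_nhds (x := (1 : ℝ)))
      simpa using h

lemma IsTestFn.comp_inv_smul {χ : Euc N → ℝ} (hχ : IsTestFn χ) {r : ℝ} (hr : r ≠ 0) :
    IsTestFn (fun x => χ (r⁻¹ • x)) :=
  ⟨hχ.1.comp (by fun_prop),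
    hχ.2.comp_homeomorph (Homeomorph.smulOfNeZero r⁻¹ (inv_ne_zero hr))⟩

lemma IsTestFn.exists_levyIncrement_dilation_bound {χ : Euc N → ℝ} (hχ : IsTestFn χ) :
    ∃ K : ℝ, 0 ≤ K ∧ ∀ r : ℝ, 0 < r → ∀ x z,
      |levyIncrement (fun y => χ (r⁻¹ • y)) x z| ≤ K * dilationBound r z := by
  obtain ⟨K, hK0, hK1, hK2, hK3⟩ := hχ.exists_taylor_bound
  refine ⟨K, hK0, fun r hr x z => ?_⟩
  have hnorm : ‖r⁻¹ • z‖ = ‖z‖ / r := by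
    rw [norm_smul, norm_inv, Real.norm_of_nonneg hr.le, inv_mul_eq_div]
  simp only [levyIncrement, dilationBound, smul_add]
  split_ifs with hz
  · have h := hK3 (r⁻¹ • x) (r⁻¹ • z)
    rw [hnorm, div_pow] at h
    simpa [fderiv_comp_smul] using h
  · rw [sub_zero, mul_min_of_nonneg _ _ hK0, mul_one]
    refine le_min ?_ (hK2 _ _)
    rw [← hnorm]
    exact hK1 _ _

/-- Probability measures satisfying the resolvent identity for restrictions of a common Lévy
measure form a tight set. -/
lemma IsLevyMeasure.isTightMeasureSet_resolvent {μ : Measure (Euc N)} (hμ : IsLevyMeasure μ)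
    {ε : ℝ} (hε : 0 < ε) (S : Set (ProbabilityMeasure (Euc N)))
    (hS : ∀ P ∈ S, ∃ ν ≤ μ, IsLevyMeasure ν ∧ ∀ ψ : Euc N → ℝ, IsTestFn ψ →
      ε * ∫ z, ψ z ∂(P : Measure (Euc N)) =
        ε * ψ 0 + ∫ z, Lop ν ψ z ∂(P : Measure (Euc N))) :
    IsTightMeasureSet {((P : ProbabilityMeasure (Euc N)) : Measure (Euc N)) | P ∈ S} := by
  let χ : ContDiffBump (0 : Euc N) := ⟨1, 2, one_pos, one_lt_two⟩
  have hχ : IsTestFn χ := ⟨χ.contDiff, χ.hasCompactSupport⟩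
  obtain ⟨K, hK0, hK⟩ := hχ.exists_levyIncrement_dilation_bound
  rw [isTightMeasureSet_iff_exists_isCompact_measure_compl_le]
  intro δ hδ
  have hlim : Tendsto (fun r : ℝ => ENNReal.ofReal (K * (∫ z, dilationBound r z ∂μ) / ε)) atTop
      (nhds 0) := by
    have := ENNReal.tendsto_ofReal ((hμ.tendsto_integral_dilationBound.const_mul K).div_const ε)
    simpa using this
  obtain ⟨r, hrδ, hr1⟩ := ((hlim.eventually_le_const hδ).and (eventually_ge_atTop (1 : ℝ))).exists
  have hr0 : 0 < r := by linarith
  refine ⟨Metric.closedBall 0 (2 * r), isCompact_closedBall _ _, ?_⟩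
  rintro _ ⟨P, hP, rfl⟩
  refine le_trans ?_ hrδ
  obtain ⟨ν, hνμ, hν, hres⟩ := hS P hP
  have hψ := hχ.comp_inv_smul hr0.ne'
  have hψ1 : χ (r⁻¹ • (0 : Euc N)) = 1 := χ.one_of_mem_closedBall (by simp [χ])
  have hL : ∀ x, |Lop ν (fun y => χ (r⁻¹ • y)) x| ≤ K * ∫ z, dilationBound r z ∂μ := by
    intro x
    refine (abs_Lop_le ((hν.integrable_dilationBound hr1).const_mul K) (hK r hr0 x)).trans ?_
    rw [integral_const_mul]
    gcongr
    · exact Eventually.of_forall fun z => dilationBound_nonneg hr0 z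
    · exact hμ.integrable_dilationBound hr1
  have hPL : |∫ z, Lop ν (fun y => χ (r⁻¹ • y)) z ∂(P : Measure (Euc N))|
      ≤ K * ∫ z, dilationBound r z ∂μ := by
    have := norm_integral_le_of_norm_le_const (μ := (P : Measure (Euc N)))
      (f := Lop ν fun y => χ (r⁻¹ • y)) (Eventually.of_forall hL)
    simpa using this
  have hle : ∫ z, χ (r⁻¹ • z) ∂(P : Measure (Euc N))
      ≤ (P : Measure (Euc N)).real (Metric.closedBall 0 (2 * r)) := by
    rw [← integral_indicator_one Metric.isClosed_closedBall.measurableSet]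
    refine integral_mono_of_nonneg (Eventually.of_forall fun z => χ.nonneg)
      ((integrable_const 1).indicator Metric.isClosed_closedBall.measurableSet)
      (Eventually.of_forall fun z => ?_)
    by_cases hz : z ∈ Metric.closedBall (0 : Euc N) (2 * r)
    · simpa [indicator_of_mem hz] using χ.le_one
    · rw [indicator_of_notMem hz]
      refine (χ.zero_of_le_dist ?_).le
      simp only [mem_closedBall_zero_iff, not_le] at hz
      rw [dist_zero_right, norm_smul, norm_inv, Real.norm_of_nonneg hr0.le, inv_mul_eq_div,
        le_div_iff₀ hr0]
      exact hz.le
  have hmain := hres _ hψ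
  rw [← ofReal_measureReal, measureReal_compl Metric.isClosed_closedBall.measurableSet,
    probReal_univ]
  refine ENNReal.ofReal_le_ofReal ?_
  rw [le_div_iff₀ hε]
  simp only [hψ1] at hmain
  nlinarith [(abs_le.1 hPL).1]

/-! ### The resolvent kernel of a Lévy measure -/

lemma IsLevyMeasure.tendsto_integral_min_closedBall {μ : Measure (Euc N)} (hμ : IsLevyMeasure μ) :
    Tendsto (fun n : ℕ => ∫ z in {z : Euc N | 1 / ((n : ℝ) + 1) < ‖z‖}ᶜ, min (‖z‖ ^ 2) 1 ∂μ)
      atTop (nhds 0) := by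
  have hs : ∀ n : ℕ, MeasurableSet {z : Euc N | 1 / ((n : ℝ) + 1) < ‖z‖}ᶜ := fun n =>
    (measurableSet_lt (by fun_prop) (by fun_prop)).compl
  have h := tendsto_setIntegral_of_antitone (μ := μ) (f := fun z : Euc N => min (‖z‖ ^ 2) 1) hs
    (fun m n hmn => compl_subset_compl.2 fun z (hz : _ < ‖z‖) =>
      show _ < ‖z‖ from (Nat.one_div_le_one_div hmn).trans_lt hz) ⟨0, hμ.integrable_min.integrableOn⟩
  have hzero : μ (⋂ n : ℕ, {z : Euc N | 1 / ((n : ℝ) + 1) < ‖z‖}ᶜ) = 0 := by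
    refine measure_mono_null (fun z hz => ?_) hμ.1
    by_contra hne
    obtain ⟨n, hn⟩ := exists_nat_one_div_lt (norm_pos_iff.2 hne)
    exact mem_iInter.1 hz n hn
  rwa [setIntegral_measure_zero _ hzero] at h

/-- The resolvent kernel of a Lévy measure: a probability measure `P` such that
`∫ (ε ψ - L^μ[ψ]) dP = ε ψ(0)` for all test functions `ψ`. -/
lemma IsLevyMeasure.exists_resolvent {μ : Measure (Euc N)} (hμ : IsLevyMeasure μ)
    {ε : ℝ} (hε : 0 < ε) :
    ∃ P : ProbabilityMeasure (Euc N), ∀ ψ : Euc N → ℝ, IsTestFn ψ →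
      ∫ z, (ε * ψ z - Lop μ ψ z) ∂(P : Measure (Euc N)) = ε * ψ 0 := by
  let A : ℕ → Set (Euc N) := fun n => {z | 1 / ((n : ℝ) + 1) < ‖z‖}
  have hA : ∀ n, MeasurableSet (A n) := fun n => measurableSet_lt (by fun_prop) (by fun_prop)
  have hν : ∀ n, IsLevyMeasure (μ.restrict (A n)) := fun n => hμ.restrict_norm_gt _
  have hfin : ∀ n, IsFiniteMeasure (μ.restrict (A n)) := fun n =>
    isFiniteMeasure_restrict.2 (hμ.measure_norm_gt_lt_top Nat.one_div_pos_of_nat).ne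
  choose P hP using fun n => (hν n).exists_resolvent_of_isFiniteMeasure hε
  have hcomp := isCompact_closure_of_isTightMeasureSet
    (hμ.isTightMeasureSet_resolvent hε (range P) (by
      rintro _ ⟨n, rfl⟩
      exact ⟨_, Measure.restrict_le_self, hν n, hP n⟩))
  obtain ⟨Q, -, hQ⟩ := hcomp.ultrafilter_le_nhds ((hyperfilter ℕ).map P)
    (le_principal_iff.2 (mem_map.2 (Eventually.of_forall fun n =>
      subset_closure (mem_range_self n))))
  have hPQ : Tendsto P (hyperfilter ℕ : Filter ℕ) (nhds Q) := hQ
  refine ⟨Q, fun ψ hψ => ?_⟩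
  obtain ⟨B, hB⟩ := hψ.exists_bound
  obtain ⟨C, hC⟩ := hψ.exists_Lop_bound hμ
  obtain ⟨K, hK0, hK⟩ := hψ.exists_levyIncrement_bound
  have hc1 := hψ.continuous
  have hc2 := hψ.continuous_Lop hμ
  have hlim := ProbabilityMeasure.tendsto_iff_forall_integral_tendsto.1 hPQ
    (BoundedContinuousFunction.ofNormedAddCommGroup (fun z => ε * ψ z - Lop μ ψ z)
      (by fun_prop) (ε * B + C) fun z => by
        refine (norm_sub_le _ _).trans (add_le_add ?_ (hC z))
        rw [norm_mul, Real.norm_of_nonneg hε.le]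
        exact mul_le_mul_of_nonneg_left (hB z) hε.le)
  refine tendsto_nhds_unique hlim (Tendsto.mono_left ?_ Nat.hyperfilter_le_atTop)
  have hdiff : ∀ n x, |Lop (μ.restrict (A n)) ψ x - Lop μ ψ x|
      ≤ K * ∫ z in (A n)ᶜ, min (‖z‖ ^ 2) 1 ∂μ := by
    intro n x
    have hsplit := integral_add_compl (hA n) (hψ.integrable_levyIncrement hμ x)
    have : Lop (μ.restrict (A n)) ψ x - Lop μ ψ x = -Lop (μ.restrict (A n)ᶜ) ψ x := by
      simp only [Lop_eq_integral_levyIncrement]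
      linarith
    rw [this, abs_neg, ← integral_const_mul]
    exact abs_Lop_le (hμ.integrable_min.const_mul K).restrict (hK x)
  rw [tendsto_iff_dist_tendsto_zero]
  refine squeeze_zero (fun _ => dist_nonneg) (fun n => ?_)
    (by simpa using hμ.tendsto_integral_min_closedBall.const_mul K)
  have hc3 := hψ.continuous_Lop (hν n)
  obtain ⟨D, hD⟩ := hψ.exists_Lop_bound (hν n)
  have hi1 : Integrable ψ (P n : Measure (Euc N)) :=
    Integrable.of_bound (by fun_prop) B (Eventually.of_forall hB)
  have hi2 : Integrable (Lop μ ψ) (P n : Measure (Euc N)) :=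
    Integrable.of_bound (by fun_prop) C (Eventually.of_forall hC)
  have hi3 : Integrable (Lop (μ.restrict (A n)) ψ) (P n : Measure (Euc N)) :=
    Integrable.of_bound (by fun_prop) D (Eventually.of_forall hD)
  have heq : ∫ z, (ε * ψ z - Lop μ ψ z) ∂(P n : Measure (Euc N)) - ε * ψ 0
      = ∫ z, (Lop (μ.restrict (A n)) ψ z - Lop μ ψ z) ∂(P n : Measure (Euc N)) := by
    rw [integral_sub (hi1.const_mul ε) hi2, integral_sub hi3 hi2, integral_const_mul, hP n ψ hψ]
    ring
  have hbound := norm_integral_le_of_norm_le_const (μ := (P n : Measure (Euc N)))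
    (f := fun z => Lop (μ.restrict (A n)) ψ z - Lop μ ψ z) (Eventually.of_forall (hdiff n))
  rw [← heq] at hbound
  simpa [Real.dist_eq, A] using hbound

/-! ### Convolution with the resolvent kernel -/

/-- The average of the translates of `g` with respect to `P`. -/
noncomputable def translateAverage (P : Measure (Euc N)) (g : Euc N → ℝ) (x : Euc N) : ℝ :=
  ∫ z, g (x - z) ∂P

lemma aestronglyMeasurable_prod_comp_sub {g : Euc N → ℝ}
    (hg : AEStronglyMeasurable g (volume : Measure (Euc N))) (P : Measure (Euc N)) [SFinite P] :
    AEStronglyMeasurable (fun p : Euc N × Euc N => g (p.2 - p.1)) (P.prod volume) :=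
  (hg.comp_snd (μ := P)).comp_measurePreserving
    (measurePreserving_prod_sub P (volume : Measure (Euc N)))

lemma aestronglyMeasurable_translateAverage {g : Euc N → ℝ}
    (hg : AEStronglyMeasurable g (volume : Measure (Euc N))) (P : Measure (Euc N)) [SFinite P] :
    AEStronglyMeasurable (translateAverage P g) (volume : Measure (Euc N)) :=
  (aestronglyMeasurable_prod_comp_sub hg P).prod_swap.integral_prod_right'

lemma integrable_prod_comp_sub {g : Euc N → ℝ} (hg : Integrable g (volume : Measure (Euc N)))
    (P : Measure (Euc N)) [IsFiniteMeasure P] :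
    Integrable (fun p : Euc N × Euc N => g (p.2 - p.1)) (P.prod volume) :=
  (measurePreserving_prod_sub P (volume : Measure (Euc N))).integrable_comp_of_integrable
    (hg.comp_snd P)

lemma integrable_translateAverage {g : Euc N → ℝ} (hg : Integrable g (volume : Measure (Euc N)))
    (P : Measure (Euc N)) [IsFiniteMeasure P] :
    Integrable (translateAverage P g) (volume : Measure (Euc N)) :=
  (integrable_prod_comp_sub hg P).integral_prod_right

lemma integral_abs_translateAverage_le {g : Euc N → ℝ}
    (hg : Integrable g (volume : Measure (Euc N)))
    (P : Measure (Euc N)) [IsProbabilityMeasure P] :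
    ∫ x, |translateAverage P g x| ≤ ∫ x, |g x| := by
  have hintg := (integrable_prod_comp_sub hg P).abs
  calc ∫ x, |translateAverage P g x| ≤ ∫ x, ∫ z, |g (x - z)| ∂P :=
        integral_mono (integrable_translateAverage hg P).abs hintg.integral_prod_right
          fun x => abs_integral_le_integral_abs
    _ = ∫ z, (∫ x, |g (x - z)|) ∂P := (integral_integral_swap hintg).symm
    _ = ∫ x, |g x| := by
      simp only [fun z => integral_sub_right_eq_self (μ := (volume : Measure (Euc N)))
        (fun x => |g x|) z]
      simp

lemma abs_translateAverage_le {g : Euc N → ℝ}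
    {C : ℝ} (hC : ∀ᵐ x : Euc N ∂volume, |g x| ≤ C) (P : Measure (Euc N)) [IsProbabilityMeasure P] :
    ∀ᵐ x : Euc N ∂volume, |translateAverage P g x| ≤ C := by
  have h1 : ∀ᵐ p : Euc N × Euc N ∂(P.prod volume), |g (p.2 - p.1)| ≤ C :=
    ((Measure.quasiMeasurePreserving_snd (μ := P)).comp
      (measurePreserving_prod_sub P (volume : Measure (Euc N))).quasiMeasurePreserving).ae hC
  have h2 : ∀ᵐ p : Euc N × Euc N ∂(volume.prod P), |g (p.1 - p.2)| ≤ C :=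
    (Measure.measurePreserving_swap (μ := volume) (ν := P)).quasiMeasurePreserving.ae h1
  filter_upwards [Measure.ae_ae_of_ae_prod h2] with x hx
  have := norm_integral_le_of_norm_le_const (f := fun z => g (x - z)) hx
  simpa [translateAverage] using this

/-- Fubini for the pairing of `g` with the average of the translates of `F`. -/
lemma integral_mul_average {g F : Euc N → ℝ} {P : Measure (Euc N)} [IsProbabilityMeasure P]
    (h : Integrable (fun p : Euc N × Euc N => g p.2 * F (p.2 + p.1)) (P.prod volume)) :
    ∫ z, (∫ x, g x * F (x + z)) ∂P = ∫ x, g x * ∫ z, F (x + z) ∂P := by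
  rw [integral_integral_swap h]
  simp only [integral_const_mul]

lemma integral_translateAverage_mul {g F : Euc N → ℝ} {P : Measure (Euc N)}
    [IsProbabilityMeasure P]
    (h : Integrable (fun p : Euc N × Euc N => g p.2 * F (p.2 + p.1)) (P.prod volume)) :
    ∫ x, translateAverage P g x * F x = ∫ x, g x * ∫ z, F (x + z) ∂P := by
  have h' : Integrable (fun p : Euc N × Euc N => g (p.2 - p.1) * F p.2) (P.prod volume) := by
    have := (measurePreserving_prod_sub P (volume : Measure (Euc N))).integrable_comp_of_integrable h
    simpa [Function.comp_def] using this
  rw [← integral_mul_average h]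
  calc ∫ x, translateAverage P g x * F x = ∫ x, ∫ z, g (x - z) * F x ∂P := by
        simp only [translateAverage, integral_mul_const]
    _ = ∫ z, (∫ x, g (x - z) * F x) ∂P := (integral_integral_swap h').symm
    _ = ∫ z, (∫ x, g x * F (x + z)) ∂P := by
      refine integral_congr_ae (Eventually.of_forall fun z => ?_)
      have := integral_sub_right_eq_self (μ := (volume : Measure (Euc N)))
        (fun x => g x * F (x + z)) z
      simpa using this

lemma integrable_prod_mul_of_integrable_left {g F : Euc N → ℝ}
    (hg : Integrable g (volume : Measure (Euc N))) (hF : Continuous F) {C : ℝ}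
    (hC : ∀ x, |F x| ≤ C) (P : Measure (Euc N)) [IsFiniteMeasure P] :
    Integrable (fun p : Euc N × Euc N => g p.2 * F (p.2 + p.1)) (P.prod volume) :=
  (hg.comp_snd P).mul_bdd (c := C) (by fun_prop) (Eventually.of_forall fun p => hC _)

lemma integrable_prod_mul_of_integrable_right {g F : Euc N → ℝ} (hg : MemLinfRn g)
    (hF : Integrable F (volume : Measure (Euc N))) (P : Measure (Euc N)) [IsFiniteMeasure P] :
    Integrable (fun p : Euc N × Euc N => g p.2 * F (p.2 + p.1)) (P.prod volume) := by
  obtain ⟨hgm, C, hC⟩ := hg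
  exact (integrable_prod_comp_add hF P).bdd_mul (c := C) hgm.comp_snd
    (Measure.quasiMeasurePreserving_snd.ae hC)

/-! ### Existence and uniqueness from the resolvent kernel -/

lemma average_resolvent {μ : Measure (Euc N)} {ε : ℝ} {P : Measure (Euc N)}
    (hP : ∀ ψ : Euc N → ℝ, IsTestFn ψ → ∫ z, (ε * ψ z - Lop μ ψ z) ∂P = ε * ψ 0)
    {ψ : Euc N → ℝ} (hψ : IsTestFn ψ) (x : Euc N) :
    ∫ z, (ε * ψ (x + z) - Lop μ ψ (x + z)) ∂P = ε * ψ x := by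
  have := hP _ (hψ.comp_add_right x)
  simp only [Lop_comp_add_right, zero_add] at this
  simpa only [add_comm x] using this

/-- The solution `ε⁻¹ P ∗ g` satisfies the resolvent equation in the sense of distributions. -/
lemma isDistributionalSolution_translateAverage {μ : Measure (Euc N)} {ε : ℝ} (hε : 0 < ε)
    {P : Measure (Euc N)} [IsProbabilityMeasure P]
    (hP : ∀ ψ : Euc N → ℝ, IsTestFn ψ → ∫ z, (ε * ψ z - Lop μ ψ z) ∂P = ε * ψ 0)
    {g ψ : Euc N → ℝ} (hψ : IsTestFn ψ)
    (h : Integrable (fun p : Euc N × Euc N =>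
      g p.2 * (ε * ψ (p.2 + p.1) - Lop μ ψ (p.2 + p.1))) (P.prod volume)) :
    ∫ x, (ε * (ε⁻¹ * translateAverage P g x) * ψ x - ε⁻¹ * translateAverage P g x * Lop μ ψ x)
      = ∫ x, g x * ψ x := by
  have h1 := integral_translateAverage_mul (F := fun x => ε * ψ x - Lop μ ψ x) h
  simp only [average_resolvent hP hψ] at h1
  calc _ = ∫ x, ε⁻¹ * (translateAverage P g x * (ε * ψ x - Lop μ ψ x)) := by
        congr 1; ext x; ring
    _ = ∫ x, g x * ψ x := by
      rw [integral_const_mul, h1, ← integral_const_mul]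
      congr 1; ext x; field_simp

/-- Distributional solutions of the homogeneous resolvent equation vanish. -/
lemma ae_eq_zero_of_resolvent {μ : Measure (Euc N)} {ε : ℝ} (hε : 0 < ε)
    {P : Measure (Euc N)} [IsProbabilityMeasure P]
    (hP : ∀ ψ : Euc N → ℝ, IsTestFn ψ → ∫ z, (ε * ψ z - Lop μ ψ z) ∂P = ε * ψ 0)
    {w : Euc N → ℝ} (hw : LocallyIntegrable w (volume : Measure (Euc N)))
    (h : ∀ ψ : Euc N → ℝ, IsTestFn ψ → Integrable (fun p : Euc N × Euc N =>
      w p.2 * (ε * ψ (p.2 + p.1) - Lop μ ψ (p.2 + p.1))) (P.prod volume))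
    (hsol : ∀ ψ : Euc N → ℝ, IsTestFn ψ → ∫ x, w x * (ε * ψ x - Lop μ ψ x) = 0) :
    ∀ᵐ x : Euc N ∂volume, w x = 0 := by
  refine ae_eq_zero_of_integral_contDiff_smul_eq_zero hw fun ψ hψ1 hψ2 => ?_
  have hψ : IsTestFn ψ := ⟨hψ1, hψ2⟩
  have h1 := integral_mul_average (F := fun x => ε * ψ x - Lop μ ψ x) (h ψ hψ)
  have h2 : ∀ z, ∫ x, w x * (ε * ψ (x + z) - Lop μ ψ (x + z)) = 0 := fun z => by
    simpa only [Lop_comp_add_right] using hsol _ (hψ.comp_add_right z)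
  simp only [average_resolvent hP hψ, h2, integral_zero] at h1
  have h3 : ε * ∫ x, ψ x • w x = 0 := by
    rw [← integral_const_mul, h1]
    congr 1; ext x; simp only [smul_eq_mul]; ring
  exact (mul_eq_zero.1 h3).resolve_left hε.ne.symm

/-- Two distributional solutions with the same datum agree, provided their products with the
functions `ε ψ - L^μ[ψ]` are integrable. -/
lemma ae_eq_of_resolvent {μ : Measure (Euc N)} {ε : ℝ} (hε : 0 < ε)
    {P : Measure (Euc N)} [IsProbabilityMeasure P]
    (hP : ∀ ψ : Euc N → ℝ, IsTestFn ψ → ∫ z, (ε * ψ z - Lop μ ψ z) ∂P = ε * ψ 0)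
    {g v w : Euc N → ℝ} (hv : LocallyIntegrable v (volume : Measure (Euc N)))
    (hw : LocallyIntegrable w (volume : Measure (Euc N)))
    (hvi : ∀ ψ : Euc N → ℝ, IsTestFn ψ → Integrable (fun x => v x * (ε * ψ x - Lop μ ψ x)))
    (hwi : ∀ ψ : Euc N → ℝ, IsTestFn ψ → Integrable (fun x => w x * (ε * ψ x - Lop μ ψ x)))
    (h : ∀ ψ : Euc N → ℝ, IsTestFn ψ → Integrable (fun p : Euc N × Euc N =>
      (w p.2 - v p.2) * (ε * ψ (p.2 + p.1) - Lop μ ψ (p.2 + p.1))) (P.prod volume))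
    (hvs : ∀ ψ : Euc N → ℝ, IsTestFn ψ →
      ∫ x, (ε * v x * ψ x - v x * Lop μ ψ x) = ∫ x, g x * ψ x)
    (hws : ∀ ψ : Euc N → ℝ, IsTestFn ψ →
      ∫ x, (ε * w x * ψ x - w x * Lop μ ψ x) = ∫ x, g x * ψ x) :
    w =ᵐ[(volume : Measure (Euc N))] v := by
  have h0 := ae_eq_zero_of_resolvent hε hP (hw.sub hv) h fun ψ hψ => by
    have hmul : ∀ u : Euc N → ℝ, (fun x => ε * u x * ψ x - u x * Lop μ ψ x)
        = fun x => u x * (ε * ψ x - Lop μ ψ x) := fun u => by ext x; ring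
    have h1 := hvs ψ hψ
    have h2 := hws ψ hψ
    rw [hmul] at h1 h2
    simp only [Pi.sub_apply, sub_mul]
    rw [integral_sub (hwi ψ hψ) (hvi ψ hψ), h1, h2, sub_self]
  filter_upwards [h0] with x hx
  exact sub_eq_zero.1 hx

lemma IsTestFn.continuous_resolvent {μ : Measure (Euc N)} (hμ : IsLevyMeasure μ) (ε : ℝ)
    {ψ : Euc N → ℝ} (hψ : IsTestFn ψ) : Continuous fun x => ε * ψ x - Lop μ ψ x :=
  (hψ.continuous.const_mul ε).sub (hψ.continuous_Lop hμ)

lemma IsTestFn.integrable_resolvent {μ : Measure (Euc N)} (hμ : IsLevyMeasure μ) (ε : ℝ)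
    {ψ : Euc N → ℝ} (hψ : IsTestFn ψ) :
    Integrable (fun x => ε * ψ x - Lop μ ψ x) (volume : Measure (Euc N)) :=
  (hψ.integrable.const_mul ε).sub (hψ.integrable_Lop hμ)

lemma IsTestFn.exists_resolvent_bound {μ : Measure (Euc N)} (hμ : IsLevyMeasure μ) (ε : ℝ)
    {ψ : Euc N → ℝ} (hψ : IsTestFn ψ) : ∃ C, ∀ x, |ε * ψ x - Lop μ ψ x| ≤ C := by
  obtain ⟨B, hB⟩ := hψ.exists_bound
  obtain ⟨C, hC⟩ := hψ.exists_Lop_bound hμ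
  refine ⟨|ε| * B + C, fun x => (abs_sub _ _).trans (add_le_add ?_ (hC x))⟩
  rw [abs_mul]
  exact mul_le_mul_of_nonneg_left (hB x) (abs_nonneg ε)

lemma MemLinfRn.sub {u v : Euc N → ℝ} (hu : MemLinfRn u) (hv : MemLinfRn v) :
    MemLinfRn fun x => u x - v x := by
  obtain ⟨hum, A, hA⟩ := hu
  obtain ⟨hvm, B, hB⟩ := hv
  refine ⟨hum.sub hvm, A + B, ?_⟩
  filter_upwards [hA, hB] with x hx hy using (abs_sub _ _).trans (add_le_add hx hy)

lemma MemLinfRn.locallyIntegrable {u : Euc N → ℝ} (hu : MemLinfRn u) :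
    LocallyIntegrable u (volume : Measure (Euc N)) := by
  obtain ⟨hum, A, hA⟩ := hu
  exact (memLp_top_of_bound hum A hA).locallyIntegrable le_top

lemma MemLinfRn.integrable_mul {u F : Euc N → ℝ} (hu : MemLinfRn u)
    (hF : Integrable F (volume : Measure (Euc N))) : Integrable fun x => u x * F x := by
  obtain ⟨hum, A, hA⟩ := hu
  exact hF.bdd_mul (c := A) hum hA

end Resolvent

/-- Resolvent equation: existence, uniqueness and bounds (Theorem 3.1 (b), (c)).
(i) For `g ∈ L¹` there is a unique distributional solution `v ∈ L¹` of `εv − L^μ[v] = g`,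
with `ε‖v‖_{L¹} ≤ ‖g‖_{L¹}`. (ii) For `g ∈ L^∞` there is a unique distributional solution
`v ∈ L^∞`, with `ε‖v‖_{L^∞} ≤ ‖g‖_{L^∞}`. -/
theorem resolvent_equation_wellposedness
    (N : ℕ) (hN : 0 < N)
    (μ : Measure (Euc N)) (hμ : IsLevyMeasure μ)
    (ε : ℝ) (hε : 0 < ε) :
    (∀ g : Euc N → ℝ, Integrable g (volume : Measure (Euc N)) →
      ∃ v : Euc N → ℝ, Integrable v (volume : Measure (Euc N)) ∧
        (∀ ψ : Euc N → ℝ, IsTestFn ψ →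
          ∫ x, (ε * v x * ψ x - v x * Lop μ ψ x) = ∫ x, g x * ψ x) ∧
        (ε * ∫ x, |v x| ≤ ∫ x, |g x|) ∧
        (∀ w : Euc N → ℝ, Integrable w (volume : Measure (Euc N)) →
          (∀ ψ : Euc N → ℝ, IsTestFn ψ →
            ∫ x, (ε * w x * ψ x - w x * Lop μ ψ x) = ∫ x, g x * ψ x) →
          w =ᵐ[(volume : Measure (Euc N))] v)) ∧
    (∀ g : Euc N → ℝ, MemLinfRn g →
      ∃ v : Euc N → ℝ, MemLinfRn v ∧
        (∀ ψ : Euc N → ℝ, IsTestFn ψ →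
          ∫ x, (ε * v x * ψ x - v x * Lop μ ψ x) = ∫ x, g x * ψ x) ∧
        (∀ C : ℝ, (∀ᵐ x : Euc N ∂volume, |g x| ≤ C) →
          ∀ᵐ x : Euc N ∂volume, ε * |v x| ≤ C) ∧
        (∀ w : Euc N → ℝ, MemLinfRn w →
          (∀ ψ : Euc N → ℝ, IsTestFn ψ →
            ∫ x, (ε * w x * ψ x - w x * Lop μ ψ x) = ∫ x, g x * ψ x) →
          w =ᵐ[(volume : Measure (Euc N))] v)) := by
  obtain ⟨P, hP⟩ := hμ.exists_resolvent hε
  refine ⟨fun g hg => ?_, fun g hg => ?_⟩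
  · have hsol : ∀ ψ : Euc N → ℝ, IsTestFn ψ →
        ∫ x, (ε * (ε⁻¹ * translateAverage P g x) * ψ x
          - ε⁻¹ * translateAverage P g x * Lop μ ψ x) = ∫ x, g x * ψ x := fun ψ hψ => by
      obtain ⟨C, hC⟩ := hψ.exists_resolvent_bound hμ ε
      exact isDistributionalSolution_translateAverage hε hP hψ
        (integrable_prod_mul_of_integrable_left hg (hψ.continuous_resolvent hμ ε) hC P)
    have hv := (integrable_translateAverage hg P).const_mul ε⁻¹
    have hmul : ∀ u : Euc N → ℝ, Integrable u → ∀ ψ : Euc N → ℝ, IsTestFn ψ →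
        Integrable fun x => u x * (ε * ψ x - Lop μ ψ x) := fun u hu ψ hψ => by
      obtain ⟨C, hC⟩ := hψ.exists_resolvent_bound hμ ε
      exact hu.mul_bdd (c := C) (hψ.continuous_resolvent hμ ε).aestronglyMeasurable
        (Eventually.of_forall hC)
    refine ⟨fun x => ε⁻¹ * translateAverage P g x, hv, hsol, ?_, fun w hw hws => ?_⟩
    · simp only [abs_mul, abs_of_pos (inv_pos.2 hε)]
      rw [integral_const_mul, mul_inv_cancel_left₀ hε.ne']
      exact integral_abs_translateAverage_le hg P
    · refine ae_eq_of_resolvent hε hP hv.locallyIntegrable hw.locallyIntegrable (hmul _ hv)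
        (hmul _ hw) (fun ψ hψ => ?_) hsol hws
      obtain ⟨C, hC⟩ := hψ.exists_resolvent_bound hμ ε
      exact integrable_prod_mul_of_integrable_left (hw.sub hv) (hψ.continuous_resolvent hμ ε) hC P
  · have hsol : ∀ ψ : Euc N → ℝ, IsTestFn ψ →
        ∫ x, (ε * (ε⁻¹ * translateAverage P g x) * ψ x
          - ε⁻¹ * translateAverage P g x * Lop μ ψ x) = ∫ x, g x * ψ x := fun ψ hψ =>
      isDistributionalSolution_translateAverage hε hP hψ
        (integrable_prod_mul_of_integrable_right hg (hψ.integrable_resolvent hμ ε) P)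
    have hbound : ∀ C : ℝ, (∀ᵐ x : Euc N ∂volume, |g x| ≤ C) →
        ∀ᵐ x : Euc N ∂volume, ε * |ε⁻¹ * translateAverage P g x| ≤ C := fun C hC => by
      filter_upwards [abs_translateAverage_le hC P] with x hx
      rwa [abs_mul, abs_of_pos (inv_pos.2 hε), mul_inv_cancel_left₀ hε.ne']
    have hv : MemLinfRn fun x => ε⁻¹ * translateAverage P g x := by
      obtain ⟨hgm, C, hC⟩ := hg
      refine ⟨(aestronglyMeasurable_translateAverage hgm P).const_mul _, ε⁻¹ * C, ?_⟩
      filter_upwards [hbound C hC] with x hx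
      rwa [le_inv_mul_iff₀ hε]
    refine ⟨_, hv, hsol, hbound, fun w hw hws => ?_⟩
    exact ae_eq_of_resolvent hε hP hv.locallyIntegrable hw.locallyIntegrable
      (fun ψ hψ => hv.integrable_mul (hψ.integrable_resolvent hμ ε))
      (fun ψ hψ => hw.integrable_mul (hψ.integrable_resolvent hμ ε))
      (fun ψ hψ => integrable_prod_mul_of_integrable_right (hw.sub hv)
        (hψ.integrable_resolvent hμ ε) P) hsol hws
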